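/- Let G be a finite group and N ⊴ G a normal subgroup. Suppose (𝒳,𝒦) is a G-invariant supercharacter theory of N and (𝒴,𝓛) is a supercharacter theory of G/N. Then ( 𝒴 ∪ 𝒳^G − {Irr(G/N)} , 𝒦 ∪ 𝓛̃ − {N} ) is a supercharacter theory of G, where 𝒳^G = {X^G : X ∈ 𝒳}, Irr(G/N) is identified with {χ ∈ Irr(G) : N ⊆ ker χ}, and 𝓛̃ = {L̃ : L ∈ 𝓛} with L̃ = ∪_{Ng∈L} Ng ⊆ G the preimage of L in G. -/

import Mathlib

open scoped Classical

noncomputable section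

/-- The set of irreducible complex characters of `G`. -/
def Irr (G : Type) [Group G] : Set (G → ℂ) :=
  {χ | ∃ V : FDRep ℂ G, CategoryTheory.Simple V ∧ FDRep.character V = χ}

/-- `σ_X = ∑_{ψ ∈ X} ψ(1)·ψ`. -/
def sigmaChar {G : Type} [Group G] (X : Set (G → ℂ)) : G → ℂ :=
  fun g => ∑ᶠ ψ ∈ X, ψ 1 * ψ g

/-- `P` is a set partition of the set `S`. -/
def IsPartitionOf {α : Type*} (S : Set α) (P : Set (Set α)) : Prop :=
  ∅ ∉ P ∧ (∀ p ∈ P, p ⊆ S) ∧ ∀ a ∈ S, ∃! p, p ∈ P ∧ a ∈ p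

/-- `(𝒳, 𝒦)` is a supercharacter theory of the finite group `G`. -/
def IsSCT (G : Type) [Group G] [Finite G]
    (𝒳 : Set (Set (G → ℂ))) (𝒦 : Set (Set G)) : Prop :=
  IsPartitionOf (Irr G) 𝒳 ∧ IsPartitionOf Set.univ 𝒦 ∧ 𝒳.ncard = 𝒦.ncard ∧
    ({1} : Set G) ∈ 𝒦 ∧
    ∀ X ∈ 𝒳, ∀ K ∈ 𝒦, ∀ g ∈ K, ∀ h ∈ K, sigmaChar X g = sigmaChar X h

/-- `K̂ = ∑_{g ∈ K} g ∈ ℂ[G]`. -/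
def ghat {G : Type} [Group G] (K : Set G) : MonoidAlgebra ℂ G :=
  ∑ᶠ g ∈ K, MonoidAlgebra.single g (1 : ℂ)

/-- The central idempotent `e_χ = (χ(1)/|G|) ∑_g conj(χ g)·g` attached to a character. -/
def eIdem (G : Type) [Group G] (χ : G → ℂ) : MonoidAlgebra ℂ G :=
  (χ 1 / (Nat.card G : ℂ)) •
    ∑ᶠ g : G, (starRingEnd ℂ) (χ g) • MonoidAlgebra.single g (1 : ℂ)

/-- `f_X = ∑_{ψ ∈ X} e_ψ`. -/
def fIdem (G : Type) [Group G] (X : Set (G → ℂ)) : MonoidAlgebra ℂ G :=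
  ∑ᶠ χ ∈ X, eIdem G χ

/-- Partition order: every part of `P` lies in some part of `Q`. -/
def PartLE {α : Type*} (P Q : Set (Set α)) : Prop := ∀ p ∈ P, ∃ q ∈ Q, p ⊆ q

/-- The join of two partitions of the same set: parts are connected components of
the relation "lying in a common part of `P` or of `Q`". -/
def PartJoin {α : Type*} (P Q : Set (Set α)) : Set (Set α) :=
  {C | ∃ a ∈ ⋃₀ P, C = {b | Relation.ReflTransGen
      (fun x y => (∃ p ∈ P, x ∈ p ∧ y ∈ p) ∨ ∃ q ∈ Q, x ∈ q ∧ y ∈ q) a b}}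

/-- Inner product of complex-valued functions on a finite group. -/
def cInner (H : Type) [Group H] (α β : H → ℂ) : ℂ :=
  (Nat.card H : ℂ)⁻¹ * ∑ᶠ h : H, α h * (starRingEnd ℂ) (β h)

/-- Restriction of a function on `G` to a subgroup. -/
def resChar {G : Type} [Group G] (H : Subgroup G) (χ : G → ℂ) : ↥H → ℂ := fun h => χ ↑h

/-- Extension by zero of a function on a subgroup. -/
def zeroExtend {G : Type} [Group G] (H : Subgroup G) (φ : ↥H → ℂ) : G → ℂ :=
  fun g => if h : g ∈ H then φ ⟨g, h⟩ else 0

/-- The induced class function `φ^G`. -/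
def indChar {G : Type} [Group G] (H : Subgroup G) (φ : ↥H → ℂ) : G → ℂ :=
  fun g => (Nat.card ↥H : ℂ)⁻¹ * ∑ᶠ x : G, zeroExtend H φ (x⁻¹ * g * x)

/-- The superclass of `x` with respect to a partition `𝒦` of `G`. -/
def sclass {G : Type} [Group G] (𝒦 : Set (Set G)) (x : G) : Set G := ⋃₀ {K ∈ 𝒦 | x ∈ K}

/-- Superinduction: `φ^{(G)}(x) = [G:H]·(1/|[x]|)·∑_{y ∈ [x]} φ⁰(y)`. -/
def superInd {G : Type} [Group G] (𝒦 : Set (Set G)) (H : Subgroup G) (φ : ↥H → ℂ) : G → ℂ :=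
  fun x => (H.index : ℂ) * (((sclass 𝒦 x).ncard : ℂ))⁻¹ * ∑ᶠ y ∈ sclass 𝒦 x, zeroExtend H φ y

/-- A subgroup is `𝒞`-normal when it is a union of superclasses. -/
def CNormal {G : Type} [Group G] (𝒦 : Set (Set G)) (N : Subgroup G) : Prop :=
  ∃ T ⊆ 𝒦, (N : Set G) = ⋃₀ T

/-- `Irr(G/N)` viewed inside `Irr(G)`: irreducible characters with `N` in their kernel. -/
def IrrOver {G : Type} [Group G] (N : Subgroup G) : Set (G → ℂ) :=
  {χ ∈ Irr G | ∀ n ∈ N, χ n = χ 1}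

/-- The set of irreducible constituents of the restriction of `θ` to `N`. -/
def constituentsOn {G : Type} [Group G] (N : Subgroup G) (θ : G → ℂ) : Set (↥N → ℂ) :=
  {ψ ∈ Irr ↥N | cInner ↥N (resChar N θ) ψ ≠ 0}

/-- `Irr(G|ψ)`: irreducible characters of `G` lying over `ψ ∈ Irr(N)`. -/
def irrOverChar {G : Type} [Group G] (N : Subgroup G) (ψ : ↥N → ℂ) : Set (G → ℂ) :=
  {χ ∈ Irr G | cInner ↥N (resChar N χ) ψ ≠ 0}

/-- `X^G = ⋃_{ψ ∈ X} Irr(G|ψ)` for `X ⊆ Irr(N)`. -/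
def indSet {G : Type} [Group G] (N : Subgroup G) (X : Set (↥N → ℂ)) : Set (G → ℂ) :=
  ⋃ ψ ∈ X, irrOverChar N ψ

/-- Conjugation of a normal subgroup by a group element. -/
def conjSub {G : Type} [Group G] {N : Subgroup G} (hN : N.Normal) (g : G) (n : ↥N) : ↥N :=
  ⟨g * ↑n * g⁻¹, hN.conj_mem ↑n n.2 g⟩

/-- The conjugation action of `g ∈ G` on class functions of a normal subgroup `N`. -/
def charConj {G : Type} [Group G] {N : Subgroup G} (hN : N.Normal) (g : G)
    (ψ : ↥N → ℂ) : ↥N → ℂ :=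
  fun n => ψ (conjSub hN g⁻¹ n)

/-- Inflation of a set of characters of `G/N` to characters of `G`. -/
def inflateSet {G : Type} [Group G] (N : Subgroup G) [N.Normal]
    (Y : Set (G ⧸ N → ℂ)) : Set (G → ℂ) :=
  (fun η => η ∘ (QuotientGroup.mk : G → G ⧸ N)) '' Y

/-- Deflation of a set of characters of `G` (with `N` in their kernels) to characters
of `G/N`. -/
def deflate {G : Type} [Group G] (N : Subgroup G) [N.Normal]
    (X : Set (G → ℂ)) : Set (G ⧸ N → ℂ) :=
  (fun χ => fun q : G ⧸ N => χ (Quotient.out q)) '' X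

/-- The natural map `M → MN/N ≤ G/N`. -/
def projMN {G : Type} [Group G] (M N : Subgroup G) [N.Normal] (m : ↥M) :
    ↥(M.map (QuotientGroup.mk' N)) :=
  ⟨QuotientGroup.mk' N ↑m, Subgroup.mem_map_of_mem _ m.2⟩

end

open Representation Module
open scoped ComplexOrder

section CharacterTheory

theorem cInner_eq_sum {G : Type} [Group G] [Fintype G] (α β : G → ℂ) :
    cInner G α β = (Nat.card G : ℂ)⁻¹ * ∑ g, α g * (starRingEnd ℂ) (β g) := by
  rw [cInner, finsum_eq_sum_of_fintype]

theorem exists_representation_of_mem_Irr {G : Type} [Group G] {χ : G → ℂ} (hχ : χ ∈ Irr G) :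
    ∃ (V : Type) (_ : AddCommGroup V) (_ : Module ℂ V) (_ : FiniteDimensional ℂ V)
      (ρ : Representation ℂ G V), ρ.character = χ := by
  obtain ⟨V, -, rfl⟩ := hχ
  exact ⟨V, inferInstance, inferInstance, inferInstance, V.ρ, rfl⟩

variable {G : Type} [Group G] [Finite G]

/-- Over `ℂ`, the character of a representation of a finite group satisfies
`χ(g⁻¹) = conj (χ g)`, since the representation preserves a positive definite Hermitian form. -/
theorem character_inv_eq_conj {V : Type} [AddCommGroup V] [Module ℂ V] [FiniteDimensional ℂ V]
    (ρ : Representation ℂ G V) (g : G) :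
    ρ.character g⁻¹ = (starRingEnd ℂ) (ρ.character g) := by
  have := Fintype.ofFinite G
  let b := finBasis ℂ V
  let M : G →* Matrix (Fin (finrank ℂ V)) (Fin (finrank ℂ V)) ℂ :=
    ((LinearMap.toMatrixAlgEquiv b : (V →ₗ[ℂ] V) →* _)).comp ρ
  have hM : ∀ x, ρ.character x = (M x).trace := fun x =>
    LinearMap.trace_eq_matrix_trace ℂ b (ρ x)
  have hpos : (∑ x, (M x).conjTranspose * M x).PosDef := by
    have h1 : (M 1).conjTranspose * M 1 = 1 := by simp
    rw [← Finset.add_sum_erase _ _ (Finset.mem_univ (1 : G)), h1]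
    exact Matrix.PosDef.one.add_posSemidef
      (Matrix.posSemidef_sum _ fun x _ => Matrix.posSemidef_conjTranspose_mul_self _)
  have hinv : (M g).conjTranspose * (∑ x, (M x).conjTranspose * M x) * M g =
      ∑ x, (M x).conjTranspose * M x := by
    rw [Finset.mul_sum, Finset.sum_mul]
    refine Fintype.sum_equiv (Equiv.mulRight g) _ _ fun x => ?_
    simp [Matrix.mul_assoc]
  have hgg : M g * M g⁻¹ = 1 := by rw [← map_mul]; simp
  set H := ∑ x, (M x).conjTranspose * M x
  have hH : IsUnit H.det := (Matrix.isUnit_iff_isUnit_det _).1 hpos.isUnit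
  have h2 : (M g).conjTranspose * H = H * M g⁻¹ := by
    rw [← congrArg (· * M g⁻¹) hinv]
    simp only [Matrix.mul_assoc, hgg, Matrix.mul_one]
  have h3 : M g⁻¹ = H⁻¹ * ((M g).conjTranspose * H) := by
    rw [h2, ← Matrix.mul_assoc, Matrix.nonsing_inv_mul _ hH, Matrix.one_mul]
  rw [hM, hM, h3, Matrix.trace_mul_comm, Matrix.mul_assoc, Matrix.mul_nonsing_inv _ hH,
    Matrix.mul_one, Matrix.trace_conjTranspose]
  rfl

theorem cInner_character_eq_finrank {V W : Type} [AddCommGroup V] [Module ℂ V]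
    [FiniteDimensional ℂ V] [AddCommGroup W] [Module ℂ W] [FiniteDimensional ℂ W]
    (ρ : Representation ℂ G V) (τ : Representation ℂ G W) :
    cInner G ρ.character τ.character = finrank ℂ (IntertwiningMap τ ρ) := by
  have := Fintype.ofFinite G
  have := invertibleOfNonzero (NeZero.ne (Nat.card G : ℂ))
  rw [cInner_eq_sum, ← card_inv_mul_sum_char_mul_char_eq_finrank]
  simp only [character_inv_eq_conj]

theorem cInner_of_mem_Irr {χ ψ : G → ℂ} (hχ : χ ∈ Irr G) (hψ : ψ ∈ Irr G) :
    cInner G χ ψ = if χ = ψ then 1 else 0 := by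
  have := Fintype.ofFinite G
  have := invertibleOfNonzero (NeZero.ne (Nat.card G : ℂ))
  obtain ⟨V, hV, rfl⟩ := hχ
  obtain ⟨W, hW, rfl⟩ := hψ
  have hsum := FDRep.char_orthonormal V W
  have hself := FDRep.char_orthonormal V V
  rw [if_pos ⟨CategoryTheory.Iso.refl V⟩] at hself
  have hinv : ∀ g, W.character g⁻¹ = (starRingEnd ℂ) (W.character g) :=
    character_inv_eq_conj W.ρ
  rw [cInner_eq_sum]
  simp only [← hinv]
  by_cases h : V.character = W.character
  · rw [if_pos h, ← h, hself]
  · rw [if_neg h, hsum, if_neg]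
    rintro ⟨i⟩
    exact h (FDRep.char_iso i)

theorem character_mem_Irr_iff {V : Type} [AddCommGroup V] [Module ℂ V] [FiniteDimensional ℂ V]
    (ρ : Representation ℂ G V) :
    ρ.character ∈ Irr G ↔ cInner G ρ.character ρ.character = 1 := by
  refine ⟨fun h => by rw [cInner_of_mem_Irr h h, if_pos rfl], fun h => ?_⟩
  have := Fintype.ofFinite G
  refine ⟨FDRep.of ρ, (FDRep.simple_iff_char_is_norm_one _).2 ?_, rfl⟩
  rw [cInner_eq_sum, inv_mul_eq_one₀ (NeZero.ne _)] at h
  simp only [← character_inv_eq_conj] at h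
  exact h.symm

theorem character_mem_Irr_of_isIrreducible {V : Type} [AddCommGroup V] [Module ℂ V]
    [FiniteDimensional ℂ V] (ρ : Representation ℂ G V) [IsIrreducible ρ] :
    ρ.character ∈ Irr G := by
  rw [character_mem_Irr_iff, cInner_character_eq_finrank]
  simp

theorem cInner_sum_left {ι : Type*} (s : Finset ι) (f : ι → G → ℂ) (β : G → ℂ) :
    cInner G (∑ i ∈ s, f i) β = ∑ i ∈ s, cInner G (f i) β := by
  have := Fintype.ofFinite G
  simp only [cInner_eq_sum, Finset.sum_apply, Finset.sum_mul, ← Finset.mul_sum]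
  rw [Finset.sum_comm]

theorem cInner_smul_left (c : ℂ) (α β : G → ℂ) : cInner G (c • α) β = c * cInner G α β := by
  have := Fintype.ofFinite G
  simp only [cInner_eq_sum, Pi.smul_apply, smul_eq_mul, mul_assoc, ← Finset.mul_sum]
  ring

theorem cInner_sub_left (α α' β : G → ℂ) :
    cInner G (α - α') β = cInner G α β - cInner G α' β := by
  have := Fintype.ofFinite G
  simp only [cInner_eq_sum, Pi.sub_apply, sub_mul, Finset.sum_sub_distrib, mul_sub]

theorem cInner_conj_symm (α β : G → ℂ) :
    (starRingEnd ℂ) (cInner G α β) = cInner G β α := by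
  have := Fintype.ofFinite G
  simp only [cInner_eq_sum, map_mul, map_inv₀, map_natCast, map_sum, Complex.conj_conj]
  simp only [mul_comm]

theorem finite_Irr (G : Type) [Group G] [Finite G] : (Irr G).Finite := by
  have hli : LinearIndependent ℂ (fun χ : Irr G => (χ : G → ℂ)) := by
    rw [linearIndependent_iff']
    intro s c hc χ hχ
    have h := congrArg (fun α => cInner G α χ) hc
    simp only [cInner_sum_left, cInner_smul_left, cInner_of_mem_Irr (Subtype.prop _) χ.2] at h
    simpa [← Subtype.ext_iff, hχ, cInner] using h
  exact Set.finite_coe_iff.1 hli.finite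

end CharacterTheory

section Completeness

variable {G : Type} [Group G] {V : Type} [AddCommGroup V] [Module ℂ V]

/-- The operator `∑ g, f g • ρ g` attached to a class function commutes with `ρ`. -/
theorem sum_smul_comp_comm [Fintype G] (ρ : Representation ℂ G V) {f : G → ℂ}
    (hf : ∀ g h, f (h * g * h⁻¹) = f g) (h : G) :
    (∑ g, f g • ρ g) ∘ₗ ρ h = ρ h ∘ₗ ∑ g, f g • ρ g := by
  change (∑ g, f g • ρ g) * ρ h = ρ h * ∑ g, f g • ρ g
  rw [Finset.sum_mul, Finset.mul_sum]
  refine Fintype.sum_equiv (MulAut.conj h⁻¹).toEquiv _ _ fun g => ?_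
  have := hf g h⁻¹
  simp_all [← map_mul, mul_assoc]

theorem trace_sum_smul [Fintype G] (ρ : Representation ℂ G V) (f : G → ℂ) :
    LinearMap.trace ℂ V (∑ g, f g • ρ g) = ∑ g, f g * ρ.character g := by
  simp [Representation.character]

variable [FiniteDimensional ℂ V]

theorem exists_isIrreducible_subrepresentation_le {ρ : Representation ℂ G V}
    {S : Subrepresentation ρ} (hS : S ≠ ⊥) :
    ∃ W ≤ S, IsIrreducible W.toRepresentation := by
  have hwf : WellFoundedLT (Subrepresentation ρ) :=
    StrictMono.wellFoundedLT (f := Subrepresentation.toSubmodule)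
      (Monotone.strictMono_of_injective (fun _ _ h => h) Subrepresentation.toSubmodule_injective)
  have hat : IsAtomic (Subrepresentation ρ) := inferInstance
  obtain h | ⟨W, hW, hWS⟩ := hat.eq_bot_or_exists_atom_le S
  · exact absurd h hS
  refine ⟨W, hWS, ?_⟩
  have hlift : ∀ U : Subrepresentation W.toRepresentation, U = ⊥ ∨ U = ⊤ := by
    intro U
    let U' : Subrepresentation ρ :=
      ⟨U.toSubmodule.map W.toSubmodule.subtype, by
        rintro g _ ⟨u, hu, rfl⟩
        exact ⟨W.toRepresentation g u, U.apply_mem_toSubmodule g hu, rfl⟩⟩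
    have hU' : U' ≤ W := by
      rintro _ ⟨u, -, rfl⟩
      exact u.2
    rcases hW.le_iff.1 hU' with h | h
    · refine Or.inl (Subrepresentation.toSubmodule_injective ?_)
      have h' : U.toSubmodule.map W.toSubmodule.subtype = ⊥ :=
        congrArg Subrepresentation.toSubmodule h
      exact Submodule.map_injective_of_injective W.toSubmodule.injective_subtype
        (h'.trans (Submodule.map_bot _).symm)
    · refine Or.inr (Subrepresentation.toSubmodule_injective (eq_top_iff.2 fun w _ => ?_))
      have hw : (w : V) ∈ U' := by rw [h]; exact w.2
      obtain ⟨u, hu, huw⟩ := hw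
      rwa [← Subtype.ext huw]
  have hne : (⊥ : Subrepresentation W.toRepresentation) ≠ ⊤ := by
    intro h
    refine hW.1 (eq_bot_iff.2 fun w hw => ?_)
    have hmem : (⟨w, hw⟩ : W.toSubmodule) ∈ (⊤ : Subrepresentation W.toRepresentation) :=
      Submodule.mem_top (R := ℂ)
    rw [← h] at hmem
    exact congrArg Subtype.val ((Submodule.mem_bot ℂ).1 hmem)
  exact { exists_pair_ne := ⟨⊥, ⊤, hne⟩, eq_bot_or_eq_top := hlift }

variable [Finite G]

theorem apply_one_ne_zero_of_mem_Irr {χ : G → ℂ} (hχ : χ ∈ Irr G) : χ 1 ≠ 0 := by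
  obtain ⟨V, _, _, _, ρ, rfl⟩ := exists_representation_of_mem_Irr hχ
  rw [char_one, Nat.cast_ne_zero]
  intro h
  have := finrank_zero_iff.1 h
  have h0 : ρ.character = 0 := by
    funext g
    rw [Representation.character, Subsingleton.elim (ρ g) 0, map_zero, Pi.zero_apply]
  have := (character_mem_Irr_iff ρ).1 hχ
  simp [h0, cInner] at this

/-- Schur's lemma: an operator commuting with an irreducible representation is a scalar. -/
theorem exists_eq_smul_id_of_commute {ρ : Representation ℂ G V} (hρ : ρ.character ∈ Irr G)
    (T : V →ₗ[ℂ] V) (hT : ∀ g, T ∘ₗ ρ g = ρ g ∘ₗ T) : ∃ c : ℂ, T = c • LinearMap.id := by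
  have h1 : finrank ℂ (IntertwiningMap ρ ρ) = 1 := by
    have := (character_mem_Irr_iff ρ).1 hρ
    rw [cInner_character_eq_finrank] at this
    exact_mod_cast this
  let e : IntertwiningMap ρ ρ := ⟨LinearMap.id, fun g => by simp⟩
  have he : e ≠ 0 := by
    intro h
    apply apply_one_ne_zero_of_mem_Irr hρ
    have h' : (LinearMap.id : V →ₗ[ℂ] V) = 0 := congrArg IntertwiningMap.toLinearMap h
    rw [Representation.character, map_one, Module.End.one_eq_id, h', map_zero]
  obtain ⟨c, hc⟩ := (finrank_eq_one_iff_of_nonzero' e he).1 h1 ⟨T, hT⟩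
  exact ⟨c, (congrArg IntertwiningMap.toLinearMap hc).symm⟩

theorem eq_zero_of_sum_mul_Irr_eq_zero [Fintype G] {f : G → ℂ}
    (hf : ∀ g h, f (h * g * h⁻¹) = f g) (horth : ∀ χ ∈ Irr G, ∑ g, f g * χ g = 0) : f = 0 := by
  let ρ := Representation.leftRegular ℂ G
  let T : IntertwiningMap ρ ρ := ⟨∑ g, f g • ρ g, sum_smul_comp_comm ρ hf⟩
  have hker : T.ker = ⊤ := by
    obtain ⟨C, hC⟩ := exists_isCompl T.ker
    by_cases hb : C = ⊥
    · simpa [hb] using hC.sup_eq_top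
    obtain ⟨W, hWC, hW⟩ := exists_isIrreducible_subrepresentation_le hb
    have hchar := character_mem_Irr_of_isIrreducible W.toRepresentation
    obtain ⟨c, hc⟩ := exists_eq_smul_id_of_commute hchar _
      (sum_smul_comp_comm W.toRepresentation hf)
    have htr := trace_sum_smul W.toRepresentation f
    rw [horth _ hchar, hc, map_smul, LinearMap.trace_id, ← char_one W.toRepresentation,
      smul_eq_mul, mul_eq_zero, or_iff_left (apply_one_ne_zero_of_mem_Irr hchar)] at htr
    have hWker : W ≤ T.ker := by
      intro w hw
      have h0 := congrArg (fun S => ((S ⟨w, hw⟩ : W.toSubmodule) : MonoidAlgebra ℂ G)) hc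
      simp only [htr, zero_smul, LinearMap.zero_apply, LinearMap.sum_apply,
        LinearMap.smul_apply, Submodule.coe_sum, Submodule.coe_smul, Submodule.coe_zero] at h0
      change (∑ g, f g • ρ g) w = 0
      simp only [LinearMap.sum_apply, LinearMap.smul_apply]
      exact h0
    have hbot : W = ⊥ := eq_bot_iff.2 (hC.inf_eq_bot ▸ le_inf hWker hWC)
    have hnt := hW.toNontrivial
    subst hbot
    exfalso
    apply apply_one_ne_zero_of_mem_Irr hchar
    rw [char_one]
    change ((finrank ℂ (⊥ : Submodule ℂ (MonoidAlgebra ℂ G)) : ℕ) : ℂ) = 0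
    simp
  have hT : (∑ g, f g • ρ g) (MonoidAlgebra.single 1 1) = 0 := by
    have : MonoidAlgebra.single 1 1 ∈ T.ker := by rw [hker]; exact Submodule.mem_top (R := ℂ)
    exact this
  funext x
  have := congrArg (fun a => a.coeff x) hT
  simpa [LinearMap.sum_apply, ρ, Finsupp.single_apply] using this

/-- A class function is determined by its inner products with the irreducible characters. -/
theorem eq_sum_cInner_smul_Irr {θ : G → ℂ} (hθ : ∀ g h, θ (h * g * h⁻¹) = θ g) :
    θ = ∑ χ ∈ (finite_Irr G).toFinset, cInner G θ χ • χ := by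
  have := Fintype.ofFinite G
  have hcls : ∀ χ ∈ Irr G, ∀ g h, χ (h * g * h⁻¹) = χ g := by
    rintro _ ⟨V, -, rfl⟩ g h
    exact V.char_conj g h
  rw [← sub_eq_zero]
  set δ := θ - ∑ χ ∈ (finite_Irr G).toFinset, cInner G θ χ • χ with hδ
  suffices h : (fun g => δ g⁻¹) = 0 by
    funext g
    simpa using congrFun h g⁻¹
  refine eq_zero_of_sum_mul_Irr_eq_zero (fun g h => ?_) fun χ hχ => ?_
  · have hinv : (h * g * h⁻¹)⁻¹ = h * g⁻¹ * h⁻¹ := by group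
    simp only [hδ, hinv, Pi.sub_apply, Finset.sum_apply, Pi.smul_apply, hθ]
    congr 1
    refine Finset.sum_congr rfl fun χ hχ => ?_
    rw [hcls χ ((finite_Irr G).mem_toFinset.1 hχ)]
  · have hzero : cInner G δ χ = 0 := by
      rw [hδ, cInner_sub_left, cInner_sum_left, sub_eq_zero,
        Finset.sum_eq_single_of_mem χ ((finite_Irr G).mem_toFinset.2 hχ)]
      · rw [cInner_smul_left, cInner_of_mem_Irr hχ hχ, if_pos rfl, mul_one]
      · intro ψ hψ hne
        rw [cInner_smul_left, cInner_of_mem_Irr ((finite_Irr G).mem_toFinset.1 hψ) hχ,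
          if_neg hne, mul_zero]
    rw [cInner_eq_sum, mul_eq_zero, or_iff_right (inv_ne_zero (NeZero.ne _))] at hzero
    rw [← hzero]
    obtain ⟨V, _, _, _, ρ, rfl⟩ := exists_representation_of_mem_Irr hχ
    refine Fintype.sum_equiv (Equiv.inv G) _ _ fun g => ?_
    rw [← character_inv_eq_conj, Equiv.inv_apply, inv_inv]

end Completeness

section SigmaChar

variable {G : Type} [Group G] [Finite G]

theorem sigmaChar_eq_sum {X : Set (G → ℂ)} (hX : X ⊆ Irr G) :
    sigmaChar X = ∑ ψ ∈ ((finite_Irr G).subset hX).toFinset, ψ 1 • ψ := by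
  funext g
  rw [sigmaChar, finsum_mem_eq_finite_toFinset_sum _ ((finite_Irr G).subset hX)]
  simp

theorem cInner_sigmaChar {X : Set (G → ℂ)} (hX : X ⊆ Irr G) {ψ : G → ℂ} (hψ : ψ ∈ Irr G) :
    cInner G (sigmaChar X) ψ = if ψ ∈ X then ψ 1 else 0 := by
  rw [sigmaChar_eq_sum hX, cInner_sum_left]
  have hterm : ∀ φ ∈ ((finite_Irr G).subset hX).toFinset,
      cInner G (φ 1 • φ) ψ = if φ = ψ then ψ 1 else 0 := by
    intro φ hφ
    rw [cInner_smul_left, cInner_of_mem_Irr (hX ((Set.Finite.mem_toFinset _).1 hφ)) hψ]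
    split_ifs with h <;> simp [h]
  rw [Finset.sum_congr rfl hterm, Finset.sum_ite_eq']
  simp

theorem const_one_mem_Irr (G : Type) [Group G] [Finite G] : (1 : G → ℂ) ∈ Irr G := by
  have := Fintype.ofFinite G
  have hchar : (Representation.trivial ℂ G ℂ).character = 1 := by
    funext g
    simp [Representation.character]
  rw [← hchar, character_mem_Irr_iff, hchar, cInner_eq_sum]
  simp

/-- In a supercharacter theory, the trivial character forms a part by itself. -/
theorem IsSCT.singleton_one_mem {𝒳 : Set (Set (G → ℂ))} {𝒦 : Set (Set G)}
    (h : IsSCT G 𝒳 𝒦) : ({1} : Set (G → ℂ)) ∈ 𝒳 := by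
  obtain ⟨⟨hXne, hsub, hpart⟩, ⟨hKne, -, hK⟩, hcard, -, hconst⟩ := h
  have hXfin : 𝒳.Finite := (finite_Irr G).finite_subsets.subset hsub
  have := hXfin.fintype
  have := (Set.toFinite 𝒦).fintype
  have hrep : ∀ K : 𝒦, (K : Set G).Nonempty := fun K =>
    Set.nonempty_iff_ne_empty.2 fun h0 => hKne (h0 ▸ K.2)
  choose r hr using hrep
  let Φ : (𝒳 → ℂ) →ₗ[ℂ] (𝒦 → ℂ) :=
    { toFun := fun c K => ∑ X, c X * sigmaChar (X : Set (G → ℂ)) (r K)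
      map_add' := fun c d => by
        funext K
        simp [add_mul, Finset.sum_add_distrib]
      map_smul' := fun a c => by
        funext K
        simp [Finset.mul_sum, mul_assoc] }
  have hΦ : ∀ c g, ∀ K : 𝒦, g ∈ (K : Set G) →
      (∑ X : 𝒳, c X • sigmaChar (X : Set (G → ℂ))) g = Φ c K := by
    intro c g K hg
    simp only [Finset.sum_apply, Pi.smul_apply, smul_eq_mul]
    refine Finset.sum_congr rfl fun X _ => ?_
    rw [hconst X X.2 K K.2 g hg (r K) (hr K)]
  have hcoef : ∀ (c : 𝒳 → ℂ) (X : 𝒳) (ψ : G → ℂ), ψ ∈ (X : Set (G → ℂ)) →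
      cInner G (∑ X : 𝒳, c X • sigmaChar (X : Set (G → ℂ))) ψ = c X * ψ 1 := by
    intro c X ψ hψ
    have hψI := hsub X X.2 hψ
    rw [cInner_sum_left, Finset.sum_eq_single_of_mem X (Finset.mem_univ _)]
    · rw [cInner_smul_left, cInner_sigmaChar (hsub X X.2) hψI, if_pos hψ]
    · intro Y _ hne
      rw [cInner_smul_left, cInner_sigmaChar (hsub Y Y.2) hψI, if_neg, mul_zero]
      exact fun hY => hne (Subtype.ext ((hpart ψ hψI).unique ⟨Y.2, hY⟩ ⟨X.2, hψ⟩))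
  have hinj : Function.Injective Φ := by
    rw [injective_iff_map_eq_zero]
    intro c hc
    funext X
    obtain ⟨ψ, hψ⟩ : (X : Set (G → ℂ)).Nonempty :=
      Set.nonempty_iff_ne_empty.2 fun h0 => hXne (h0 ▸ X.2)
    have hzero : ∑ X : 𝒳, c X • sigmaChar (X : Set (G → ℂ)) = 0 := by
      funext g
      obtain ⟨K, ⟨hK1, hK2⟩, -⟩ := hK g (Set.mem_univ g)
      rw [hΦ c g ⟨K, hK1⟩ hK2, hc]
      rfl
    have := hcoef c X ψ hψ
    rw [hzero] at this
    simpa [cInner, apply_one_ne_zero_of_mem_Irr (hsub X X.2 hψ)] using this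
  have hdim : finrank ℂ (𝒳 → ℂ) = finrank ℂ (𝒦 → ℂ) := by
    rw [finrank_fintype_fun_eq_card, finrank_fintype_fun_eq_card,
      Fintype.card_eq_nat_card, Fintype.card_eq_nat_card]
    exact hcard
  obtain ⟨c, hc⟩ :=
    (LinearMap.injective_iff_surjective_of_finrank_eq_finrank hdim).1 hinj (fun _ => 1)
  have hone : ∑ X : 𝒳, c X • sigmaChar (X : Set (G → ℂ)) = 1 := by
    funext g
    obtain ⟨K, ⟨hK1, hK2⟩, -⟩ := hK g (Set.mem_univ g)
    rw [hΦ c g ⟨K, hK1⟩ hK2, hc]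
    rfl
  have h1 := const_one_mem_Irr G
  obtain ⟨X, ⟨hX, h1X⟩, -⟩ := hpart 1 h1
  have hcX : c ⟨X, hX⟩ = 1 := by
    have := hcoef c ⟨X, hX⟩ 1 h1X
    rw [hone, cInner_of_mem_Irr h1 h1] at this
    simpa using this.symm
  convert hX
  refine (Set.eq_singleton_iff_unique_mem.2 ⟨h1X, fun ψ hψ => ?_⟩).symm
  by_contra hne
  have := hcoef c ⟨X, hX⟩ ψ hψ
  rw [hone, cInner_of_mem_Irr h1 (hsub X hX hψ), if_neg (Ne.symm hne), hcX, one_mul] at this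
  exact apply_one_ne_zero_of_mem_Irr (hsub X hX hψ) this.symm

end SigmaChar

section NormalSubgroup

variable {G : Type} [Group G] {N : Subgroup G}

theorem indSet_subset (X : Set (N → ℂ)) : indSet N X ⊆ Irr G :=
  Set.iUnion₂_subset fun _ _ _ h => h.1

variable [Finite G]

theorem cInner_sigmaChar_character_ne_zero_iff {X : Set (G → ℂ)} (hX : X ⊆ Irr G) {V : Type}
    [AddCommGroup V] [Module ℂ V] [FiniteDimensional ℂ V] (ρ : Representation ℂ G V) :
    cInner G (sigmaChar X) ρ.character ≠ 0 ↔ ∃ ψ ∈ X, cInner G ρ.character ψ ≠ 0 := by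
  have hnat : ∀ ψ : G → ℂ, ∃ m : ℕ, ψ ∈ X → cInner G (ψ 1 • ψ) ρ.character = m ∧
      (m ≠ 0 ↔ cInner G ρ.character ψ ≠ 0) := by
    intro ψ
    by_cases hψ : ψ ∈ X
    · obtain ⟨W, _, _, _, τ, rfl⟩ := exists_representation_of_mem_Irr (hX hψ)
      have hne := apply_one_ne_zero_of_mem_Irr (hX hψ)
      refine ⟨finrank ℂ W * finrank ℂ (IntertwiningMap ρ τ), fun _ => ⟨?_, ?_⟩⟩
      · rw [cInner_smul_left, cInner_character_eq_finrank, char_one, Nat.cast_mul]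
      · rw [char_one, Nat.cast_ne_zero] at hne
        rw [← cInner_conj_symm, map_ne_zero, cInner_character_eq_finrank, Nat.cast_ne_zero]
        simp [hne]
    · exact ⟨0, fun h => absurd h hψ⟩
  choose m hm using hnat
  rw [sigmaChar_eq_sum hX, cInner_sum_left,
    Finset.sum_congr rfl fun ψ hψ => (hm ψ ((Set.Finite.mem_toFinset _).1 hψ)).1,
    ← Nat.cast_sum, Nat.cast_ne_zero, Ne, Finset.sum_eq_zero_iff]
  push Not
  simp only [Set.Finite.mem_toFinset]
  exact exists_congr fun ψ => and_congr_right fun hψ => (hm ψ hψ).2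

/-- Every irreducible character `χ` of `G` lies over some `ψ ∈ Irr N` that decides, for each
`X ⊆ Irr N` with `G`-invariant `σ_X`, the multiplicity of `χ` in the character induced
from `σ_X`. -/
theorem exists_mem_Irr_forall_cInner_sigmaChar_resChar (hN : N.Normal) {χ : G → ℂ}
    (hχ : χ ∈ Irr G) :
    ∃ ψ ∈ Irr N, ∀ X ⊆ Irr N, (∀ g n, sigmaChar X (conjSub hN g n) = sigmaChar X n) →
      cInner N (sigmaChar X) (resChar N χ) = if ψ ∈ X then χ 1 else 0 := by
  have := Fintype.ofFinite N
  obtain ⟨V, _, _, _, ρ, rfl⟩ := exists_representation_of_mem_Irr hχ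
  let ρN : Representation ℂ N V := ρ.comp N.subtype
  have htop : (⊤ : Subrepresentation ρN) ≠ ⊥ := by
    intro h
    have h' : (⊤ : Submodule ℂ V) = ⊥ := congrArg Subrepresentation.toSubmodule h
    apply apply_one_ne_zero_of_mem_Irr hχ
    rw [char_one, ← finrank_top, h', finrank_bot, Nat.cast_zero]
  obtain ⟨W, -, hW⟩ := exists_isIrreducible_subrepresentation_le htop
  have hψ := character_mem_Irr_of_isIrreducible W.toRepresentation
  refine ⟨W.toRepresentation.character, hψ, fun X hX hinv => ?_⟩
  let T : V →ₗ[ℂ] V := ∑ n : N, sigmaChar X n • ρ (n : G)⁻¹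
  have hcomm : ∀ g, T ∘ₗ ρ g = ρ g ∘ₗ T := by
    intro g
    change (∑ n : N, sigmaChar X n • ρ (n : G)⁻¹) * ρ g =
      ρ g * ∑ n : N, sigmaChar X n • ρ (n : G)⁻¹
    rw [Finset.sum_mul, Finset.mul_sum]
    refine Fintype.sum_equiv (MulAut.conjNormal g⁻¹).toEquiv _ _ fun n => ?_
    have hconj : (MulAut.conjNormal g⁻¹).toEquiv n = conjSub hN g⁻¹ n :=
      Subtype.ext (MulAut.conjNormal_apply _ _)
    rw [hconj, hinv, smul_mul_assoc, mul_smul_comm, ← map_mul, ← map_mul]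
    congr 2
    simp [conjSub, mul_assoc]
  obtain ⟨c, hc⟩ := exists_eq_smul_id_of_commute hχ T hcomm
  have htr : ∀ {U : Type} [AddCommGroup U] [Module ℂ U] [FiniteDimensional ℂ U]
      (τ : Representation ℂ N U), ∑ n : N, sigmaChar X n • τ n⁻¹ = c • LinearMap.id →
      c * τ.character 1 = Nat.card N * cInner N (sigmaChar X) τ.character := by
    intro U _ _ _ τ h
    have h' := congrArg (LinearMap.trace ℂ U) h
    rw [map_smul, LinearMap.trace_id, ← char_one τ, smul_eq_mul] at h'
    rw [cInner_eq_sum, mul_inv_cancel_left₀ (NeZero.ne _), ← h']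
    simp only [← character_inv_eq_conj, map_sum, map_smul, smul_eq_mul]
    rfl
  have hV := htr ρN hc
  have hWtr := htr W.toRepresentation <| by
    ext w
    have h0 := LinearMap.congr_fun hc w
    simp only [T, LinearMap.sum_apply, LinearMap.smul_apply, LinearMap.id_apply] at h0 ⊢
    rw [Submodule.coe_sum, Submodule.coe_smul, ← h0]
    rfl
  rw [cInner_sigmaChar hX hψ] at hWtr
  have hcard : (Nat.card N : ℂ) ≠ 0 := NeZero.ne _
  have hχ1 : ρN.character 1 = ρ.character 1 := by simp
  rw [hχ1] at hV
  change cInner N (sigmaChar X) ρN.character = _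
  apply mul_left_cancel₀ hcard
  rw [← hV]
  split_ifs with h
  · rw [if_pos h] at hWtr
    rw [mul_right_cancel₀ (apply_one_ne_zero_of_mem_Irr hψ) hWtr]
  · rw [if_neg h, mul_zero, mul_eq_zero,
      or_iff_left (apply_one_ne_zero_of_mem_Irr hψ)] at hWtr
    rw [hWtr, zero_mul, mul_zero]

theorem mem_indSet_iff {X : Set (N → ℂ)} (hX : X ⊆ Irr N) {χ : G → ℂ} (hχ : χ ∈ Irr G) :
    χ ∈ indSet N X ↔ cInner N (sigmaChar X) (resChar N χ) ≠ 0 := by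
  obtain ⟨V, _, _, _, ρ, rfl⟩ := exists_representation_of_mem_Irr hχ
  refine Iff.trans ?_ (cInner_sigmaChar_character_ne_zero_iff hX (ρ.comp N.subtype)).symm
  simp only [indSet, irrOverChar, Set.mem_iUnion₂, Set.mem_ofPred_eq, hχ, true_and, exists_prop]
  rfl

theorem exists_forall_mem_indSet_iff (hN : N.Normal) {χ : G → ℂ} (hχ : χ ∈ Irr G) :
    ∃ ψ ∈ Irr N, ∀ X ⊆ Irr N, (∀ g n, sigmaChar X (conjSub hN g n) = sigmaChar X n) →
      (χ ∈ indSet N X ↔ ψ ∈ X) := by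
  obtain ⟨ψ, hψ, h⟩ := exists_mem_Irr_forall_cInner_sigmaChar_resChar hN hχ
  refine ⟨ψ, hψ, fun X hX hinv => ?_⟩
  rw [mem_indSet_iff hX hχ, h X hX hinv]
  simp [apply_one_ne_zero_of_mem_Irr hχ]

theorem cInner_sigmaChar_resChar (hN : N.Normal) {χ : G → ℂ} (hχ : χ ∈ Irr G)
    {X : Set (N → ℂ)} (hX : X ⊆ Irr N)
    (hinv : ∀ g n, sigmaChar X (conjSub hN g n) = sigmaChar X n) :
    cInner N (sigmaChar X) (resChar N χ) = if χ ∈ indSet N X then χ 1 else 0 := by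
  obtain ⟨ψ, -, h⟩ := exists_mem_Irr_forall_cInner_sigmaChar_resChar hN hχ
  have hmem := mem_indSet_iff hX hχ
  rw [h X hX hinv] at hmem ⊢
  simp_all [apply_one_ne_zero_of_mem_Irr hχ]

theorem cInner_zeroExtend (φ : N → ℂ) (χ : G → ℂ) :
    cInner G (zeroExtend N φ) χ = (N.index : ℂ)⁻¹ * cInner N φ (resChar N χ) := by
  have := Fintype.ofFinite G
  rw [cInner_eq_sum, cInner_eq_sum, ← N.index_mul_card, Nat.cast_mul, mul_inv, mul_assoc]
  congr 2
  rw [← Finset.sum_subset (Finset.subset_univ (Finset.univ.filter (· ∈ N)))]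
  · rw [Finset.sum_subtype (p := (· ∈ N)) _ (by simp)]
    refine Finset.sum_congr rfl fun n _ => ?_
    rw [zeroExtend, dif_pos n.2]
    rfl
  · intro g _ hg
    rw [zeroExtend, dif_neg (by simpa using hg), zero_mul]

/-- `σ_{X^G}` vanishes off `N` and equals `[G : N] σ_X` on `N`. -/
theorem sigmaChar_indSet (hN : N.Normal) {X : Set (N → ℂ)} (hX : X ⊆ Irr N)
    (hinv : ∀ g n, sigmaChar X (conjSub hN g n) = sigmaChar X n) :
    sigmaChar (indSet N X) = (N.index : ℂ) • zeroExtend N (sigmaChar X) := by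
  have hcls : ∀ g h, ((N.index : ℂ) • zeroExtend N (sigmaChar X)) (h * g * h⁻¹) =
      ((N.index : ℂ) • zeroExtend N (sigmaChar X)) g := by
    intro g h
    simp only [Pi.smul_apply, zeroExtend]
    by_cases hg : g ∈ N
    · rw [dif_pos hg, dif_pos (hN.conj_mem g hg h)]
      congr 1
      exact hinv h ⟨g, hg⟩
    · rw [dif_neg hg, dif_neg fun h' => hg (by simpa [mul_assoc] using hN.conj_mem _ h' h⁻¹)]
  have hidx : (N.index : ℂ) ≠ 0 := Nat.cast_ne_zero.2 N.index_ne_zero_of_finite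
  rw [eq_sum_cInner_smul_Irr hcls, sigmaChar_eq_sum (indSet_subset X)]
  symm
  rw [← Finset.sum_subset (s₁ := ((finite_Irr G).subset (indSet_subset X)).toFinset)]
  · refine Finset.sum_congr rfl fun χ hχ => ?_
    rw [Set.Finite.mem_toFinset] at hχ
    rw [cInner_smul_left, cInner_zeroExtend, mul_inv_cancel_left₀ hidx,
      cInner_sigmaChar_resChar hN (indSet_subset X hχ) hX hinv, if_pos hχ]
  · simpa using indSet_subset X
  · intro χ hχ hχ'
    rw [Set.Finite.mem_toFinset] at hχ hχ'
    rw [cInner_smul_left, cInner_zeroExtend, mul_inv_cancel_left₀ hidx,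
      cInner_sigmaChar_resChar hN hχ hX hinv, if_neg hχ', zero_smul]

end NormalSubgroup

section Inflation

theorem sigmaChar_singleton_one {G : Type} [Group G] :
    sigmaChar ({1} : Set (G → ℂ)) = 1 := by
  funext g
  simp [sigmaChar]

theorem inflateSet_injective {G : Type} [Group G] {N : Subgroup G} [N.Normal] :
    Function.Injective (inflateSet N : Set (G ⧸ N → ℂ) → Set (G → ℂ)) :=
  Set.image_injective.2 (QuotientGroup.mk_surjective.injective_comp_right)

theorem sigmaChar_inflateSet {G : Type} [Group G] {N : Subgroup G} [N.Normal]
    (Y : Set (G ⧸ N → ℂ)) (g : G) :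
    sigmaChar (inflateSet N Y) g = sigmaChar Y g := by
  rw [sigmaChar, inflateSet,
    finsum_mem_image (QuotientGroup.mk_surjective.injective_comp_right).injOn]
  rfl

variable {G : Type} [Group G] [Finite G]

theorem eq_one_of_average_character_eq_finrank {V : Type} [AddCommGroup V] [Module ℂ V]
    [FiniteDimensional ℂ V] {ρ : Representation ℂ G V}
    (h : cInner G ρ.character 1 = finrank ℂ V) (g : G) : ρ g = 1 := by
  have := Fintype.ofFinite G
  have := invertibleOfNonzero (NeZero.ne (Nat.card G : ℂ))
  have hinv := card_inv_mul_sum_char_eq_finrank ρ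
  rw [cInner_eq_sum] at h
  simp only [Pi.one_apply, map_one, mul_one] at h
  rw [h, Nat.cast_inj] at hinv
  have htop := Submodule.eq_top_of_finrank_eq hinv.symm
  ext v
  have hv : v ∈ ρ.invariants := htop ▸ Submodule.mem_top
  exact hv g

theorem character_comp_mem_Irr_iff {H : Type} [Group H] [Finite H] {π : G →* H}
    (hπ : Function.Surjective π) {V : Type} [AddCommGroup V] [Module ℂ V]
    [FiniteDimensional ℂ V] (τ : Representation ℂ H V) :
    Representation.character (τ.comp π : Representation ℂ G V) ∈ Irr G ↔
      τ.character ∈ Irr H := by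
  let e : IntertwiningMap (τ.comp π : Representation ℂ G V) (τ.comp π) ≃ₗ[ℂ]
      IntertwiningMap τ τ :=
    { toFun := fun f => ⟨f.toLinearMap, fun h => by
        obtain ⟨g, rfl⟩ := hπ h
        exact f.isIntertwining' g⟩
      invFun := fun f => ⟨f.toLinearMap, fun g => f.isIntertwining' (π g)⟩
      map_add' := fun _ _ => rfl
      map_smul' := fun _ _ => rfl
      left_inv := fun _ => rfl
      right_inv := fun _ => rfl }
  rw [character_mem_Irr_iff, character_mem_Irr_iff, cInner_character_eq_finrank,
    cInner_character_eq_finrank, e.finrank_eq]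

variable {N : Subgroup G}

theorem indSet_singleton_one (hN : N.Normal) : indSet N {1} = IrrOver N := by
  have := Fintype.ofFinite N
  have hsub : ({1} : Set (N → ℂ)) ⊆ Irr N := Set.singleton_subset_iff.2 (const_one_mem_Irr N)
  ext χ
  refine ⟨fun h => ?_, fun ⟨hχ, hker⟩ => ?_⟩
  · have hχ := indSet_subset _ h
    have hmul := cInner_sigmaChar_resChar hN hχ hsub (fun g n => by
      simp [sigmaChar_singleton_one])
    rw [if_pos h, sigmaChar_singleton_one] at hmul
    obtain ⟨V, _, _, _, ρ, rfl⟩ := exists_representation_of_mem_Irr hχ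
    let ρN : Representation ℂ N V := ρ.comp N.subtype
    have hρN : cInner N ρN.character 1 = finrank ℂ V := by
      rw [← cInner_conj_symm]
      change (starRingEnd ℂ) (cInner N 1 (resChar N ρ.character)) = _
      rw [hmul, char_one, map_natCast]
    refine ⟨hχ, fun n hn => ?_⟩
    have h1 : ρ n = 1 := eq_one_of_average_character_eq_finrank hρN ⟨n, hn⟩
    rw [Representation.character, Representation.character, h1, map_one ρ]
  · rw [mem_indSet_iff hsub hχ, sigmaChar_singleton_one, cInner_eq_sum]
    have hconst : ∀ n : N, resChar N χ n = χ 1 := fun n => hker n n.2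
    simp [hconst, apply_one_ne_zero_of_mem_Irr hχ]

variable [hN : N.Normal]

theorem inflateSet_Irr : inflateSet N (Irr (G ⧸ N)) = IrrOver N := by
  ext χ
  constructor
  · rintro ⟨η, hη, rfl⟩
    refine ⟨?_, fun n hn => ?_⟩
    · obtain ⟨V, _, _, _, τ, rfl⟩ := exists_representation_of_mem_Irr hη
      exact (character_comp_mem_Irr_iff (QuotientGroup.mk'_surjective N) τ).2 hη
    · simp [(QuotientGroup.eq_one_iff n).2 hn]
  · rintro ⟨hχ, hker⟩
    obtain ⟨V, _, _, _, ρ, rfl⟩ := exists_representation_of_mem_Irr hχ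
    have := Fintype.ofFinite N
    have hconst : ∀ n : N, resChar N ρ.character n = ρ.character 1 := fun n => hker n n.2
    have hρN : cInner N (Representation.character (ρ.comp N.subtype : Representation ℂ N V)) 1 =
        finrank ℂ V := by
      change cInner N (resChar N ρ.character) 1 = _
      rw [cInner_eq_sum]
      simp [hconst]
    have hone : N ≤ ρ.ker := fun n hn =>
      eq_one_of_average_character_eq_finrank hρN ⟨n, hn⟩
    let τ : Representation ℂ (G ⧸ N) V := QuotientGroup.lift N ρ hone
    have hτ : (τ.comp (QuotientGroup.mk' N) : Representation ℂ G V) = ρ := by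
      ext g : 1
      rfl
    refine ⟨τ.character, ?_, rfl⟩
    rw [← character_comp_mem_Irr_iff (QuotientGroup.mk'_surjective N) τ, hτ]
    exact hχ

end Inflation

namespace IsPartitionOf

variable {α β : Type*} {S T : Set α} {P Q : Set (Set α)}

theorem nonempty (hP : IsPartitionOf S P) {p : Set α} (hp : p ∈ P) : p.Nonempty :=
  Set.nonempty_iff_ne_empty.2 fun h => hP.1 (h ▸ hp)

theorem eq_of_mem (hP : IsPartitionOf S P) {p q : Set α} (hp : p ∈ P) (hq : q ∈ P) {a : α}
    (hap : a ∈ p) (haq : a ∈ q) : p = q :=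
  (hP.2.2 a (hP.2.1 p hp hap)).unique ⟨hp, hap⟩ ⟨hq, haq⟩

theorem union (hP : IsPartitionOf S P) (hQ : IsPartitionOf T Q) (hST : Disjoint S T) :
    IsPartitionOf (S ∪ T) (P ∪ Q) := by
  refine ⟨fun h => h.elim hP.1 hQ.1, fun p hp => ?_, fun a ha => ?_⟩
  · exact hp.elim (fun h => (hP.2.1 p h).trans Set.subset_union_left)
      fun h => (hQ.2.1 p h).trans Set.subset_union_right
  · rcases ha with ha | ha
    · obtain ⟨p, ⟨hp, hap⟩, -⟩ := hP.2.2 a ha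
      refine ⟨p, ⟨Or.inl hp, hap⟩, ?_⟩
      rintro q ⟨hq | hq, haq⟩
      · exact hP.eq_of_mem hq hp haq hap
      · exact (Set.disjoint_left.1 hST ha (hQ.2.1 q hq haq)).elim
    · obtain ⟨p, ⟨hp, hap⟩, -⟩ := hQ.2.2 a ha
      refine ⟨p, ⟨Or.inr hp, hap⟩, ?_⟩
      rintro q ⟨hq | hq, haq⟩
      · exact (Set.disjoint_left.1 hST (hP.2.1 q hq haq) ha).elim
      · exact hQ.eq_of_mem hq hp haq hap

theorem disjoint_parts (hP : IsPartitionOf S P) (hQ : IsPartitionOf T Q) (hST : Disjoint S T) :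
    Disjoint P Q := by
  refine Set.disjoint_left.2 fun p hp hq => ?_
  obtain ⟨a, ha⟩ := hP.nonempty hp
  exact Set.disjoint_left.1 hST (hP.2.1 p hp ha) (hQ.2.1 p hq ha)

theorem diff_singleton (hP : IsPartitionOf S P) {p : Set α} (hp : p ∈ P) :
    IsPartitionOf (S \ p) (P \ {p}) := by
  refine ⟨fun h => hP.1 h.1, fun q hq a ha => ⟨hP.2.1 q hq.1 ha, fun hap => ?_⟩, fun a ha => ?_⟩
  · exact hq.2 (hP.eq_of_mem hq.1 hp ha hap)
  · obtain ⟨q, ⟨hq, haq⟩, -⟩ := hP.2.2 a ha.1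
    refine ⟨q, ⟨⟨hq, ?_⟩, haq⟩, fun r hr => hP.eq_of_mem hr.1.1 hq hr.2 haq⟩
    rintro rfl
    exact ha.2 haq

theorem image (hP : IsPartitionOf S P) {f : α → β} (hf : Function.Injective f) :
    IsPartitionOf (f '' S) (Set.image f '' P) := by
  refine ⟨?_, ?_, ?_⟩
  · rintro ⟨p, hp, h⟩
    exact hP.1 (Set.image_eq_empty.1 h ▸ hp)
  · rintro _ ⟨p, hp, rfl⟩
    exact Set.image_mono (hP.2.1 p hp)
  · rintro _ ⟨a, ha, rfl⟩
    obtain ⟨p, ⟨hp, hap⟩, -⟩ := hP.2.2 a ha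
    refine ⟨f '' p, ⟨⟨p, hp, rfl⟩, Set.mem_image_of_mem f hap⟩, ?_⟩
    rintro _ ⟨⟨q, hq, rfl⟩, haq⟩
    rw [hP.eq_of_mem hq hp (hf.mem_set_image.1 haq) hap]

theorem preimage (hP : IsPartitionOf Set.univ P) {f : β → α} (hf : Function.Surjective f) :
    IsPartitionOf Set.univ (Set.preimage f '' P) := by
  refine ⟨?_, fun _ _ => Set.subset_univ _, fun b _ => ?_⟩
  · rintro ⟨p, hp, h⟩
    obtain ⟨a, ha⟩ := hP.nonempty hp
    obtain ⟨b, rfl⟩ := hf a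
    exact Set.notMem_empty b (h ▸ ha)
  · obtain ⟨p, ⟨hp, hbp⟩, -⟩ := hP.2.2 (f b) (Set.mem_univ _)
    refine ⟨f ⁻¹' p, ⟨⟨p, hp, rfl⟩, hbp⟩, ?_⟩
    rintro _ ⟨⟨q, hq, rfl⟩, hbq⟩
    rw [hP.eq_of_mem hq hp hbq hbp]

end IsPartitionOf

section StarProduct

variable {G : Type} [Group G] [Finite G] {N : Subgroup G}

theorem indSet_nonempty (hN : N.Normal) {X : Set (N → ℂ)} (hX : X ⊆ Irr N)
    (hne : X.Nonempty) (hinv : ∀ g n, sigmaChar X (conjSub hN g n) = sigmaChar X n) :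
    (indSet N X).Nonempty := by
  rw [Set.nonempty_iff_ne_empty]
  intro h
  obtain ⟨ψ, hψ⟩ := hne
  have hσ := sigmaChar_indSet hN hX hinv
  have hzero : sigmaChar X = 0 := by
    funext n
    have := congrFun hσ n
    simpa [h, sigmaChar, zeroExtend, N.index_ne_zero_of_finite] using this.symm
  have := cInner_sigmaChar hX (hX hψ)
  rw [hzero, if_pos hψ] at this
  exact apply_one_ne_zero_of_mem_Irr (hX hψ) (by simpa [cInner] using this.symm)

theorem IsPartitionOf.indSet (hN : N.Normal) {𝒳 : Set (Set (N → ℂ))}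
    (h𝒳 : IsPartitionOf (Irr N) 𝒳)
    (hinv : ∀ X ∈ 𝒳, ∀ g n, sigmaChar X (conjSub hN g n) = sigmaChar X n) :
    IsPartitionOf (Irr G) (indSet N '' 𝒳) := by
  refine ⟨?_, ?_, fun χ hχ => ?_⟩
  · rintro ⟨X, hX, h⟩
    exact (indSet_nonempty hN (h𝒳.2.1 X hX) (h𝒳.nonempty hX) (hinv X hX)).ne_empty h
  · rintro _ ⟨X, -, rfl⟩
    exact indSet_subset X
  · obtain ⟨ψ, hψ, h⟩ := exists_forall_mem_indSet_iff hN hχ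
    obtain ⟨X, ⟨hX, hψX⟩, -⟩ := h𝒳.2.2 ψ hψ
    refine ⟨_, ⟨⟨X, hX, rfl⟩, (h X (h𝒳.2.1 X hX) (hinv X hX)).2 hψX⟩, ?_⟩
    rintro _ ⟨⟨Y, hY, rfl⟩, hχY⟩
    rw [h𝒳.eq_of_mem hY hX ((h Y (h𝒳.2.1 Y hY) (hinv Y hY)).1 hχY) hψX]

theorem injOn_indSet (hN : N.Normal) {𝒳 : Set (Set (N → ℂ))} (h𝒳 : IsPartitionOf (Irr N) 𝒳)
    (hinv : ∀ X ∈ 𝒳, ∀ g n, sigmaChar X (conjSub hN g n) = sigmaChar X n) :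
    Set.InjOn (indSet N) 𝒳 := by
  intro X hX Y hY hXY
  obtain ⟨χ, hχ⟩ := indSet_nonempty hN (h𝒳.2.1 X hX) (h𝒳.nonempty hX) (hinv X hX)
  obtain ⟨ψ, -, h⟩ := exists_forall_mem_indSet_iff hN (indSet_subset X hχ)
  exact h𝒳.eq_of_mem hX hY ((h X (h𝒳.2.1 X hX) (hinv X hX)).1 hχ)
    ((h Y (h𝒳.2.1 Y hY) (hinv Y hY)).1 (hXY ▸ hχ))

end StarProduct

/-- Theorem 4.2, the `*`-product. If `(𝒳,𝒦)` is a `G`-invariant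
supercharacter theory of `N ⊴ G` and `(𝒴,𝓛)` is a supercharacter theory of `G/N`, then
`(𝒴 ∪ (𝒳^G − {Irr(G/N)}), 𝒦 ∪ (𝓛̃ − {N}))` is a supercharacter theory of `G`. -/
theorem stmt8 (G : Type) [Group G] [Finite G] (N : Subgroup G) [hN : N.Normal]
    (𝒳 : Set (Set (↥N → ℂ))) (𝒦 : Set (Set ↥N))
    (𝒴 : Set (Set (G ⧸ N → ℂ))) (𝓛 : Set (Set (G ⧸ N)))
    (hC : IsSCT ↥N 𝒳 𝒦)
    (hCinv : ∀ g : G, ∀ K ∈ 𝒦, conjSub hN g '' K = K)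
    (hD : IsSCT (G ⧸ N) 𝒴 𝓛) :
    IsSCT G
      (inflateSet N '' 𝒴 ∪ ((fun X => indSet N X) '' 𝒳 \ {IrrOver N}))
      ((fun K => (Subtype.val '' K : Set G)) '' 𝒦 ∪
        ((fun L => ((QuotientGroup.mk : G → G ⧸ N) ⁻¹' L)) '' 𝓛 \ {(N : Set G)})) := by
  obtain ⟨h𝒳, h𝒦, hcardN, honeN, hconstN⟩ := hC
  have htriv : ({1} : Set (N → ℂ)) ∈ 𝒳 :=
    IsSCT.singleton_one_mem ⟨h𝒳, h𝒦, hcardN, honeN, hconstN⟩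
  obtain ⟨h𝒴, h𝓛, hcardQ, honeQ, hconstQ⟩ := hD
  have hinv : ∀ X ∈ 𝒳, ∀ g n, sigmaChar X (conjSub hN g n) = sigmaChar X n := by
    intro X hX g n
    obtain ⟨K, ⟨hK, hnK⟩, -⟩ := h𝒦.2.2 n (Set.mem_univ n)
    refine hconstN X hX K hK _ ?_ _ hnK
    rw [← hCinv g K hK]
    exact Set.mem_image_of_mem _ hnK
  have hind := h𝒳.indSet hN hinv
  have hIrrOver : IrrOver N ∈ indSet N '' 𝒳 := ⟨{1}, htriv, indSet_singleton_one hN⟩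
  have hinfl : IsPartitionOf (IrrOver N) (inflateSet N '' 𝒴) := by
    rw [← inflateSet_Irr]
    exact h𝒴.image QuotientGroup.mk_surjective.injective_comp_right
  have hsub : IsPartitionOf (N : Set G) ((fun K => (Subtype.val '' K : Set G)) '' 𝒦) := by
    simpa using h𝒦.image (f := ((↑) : N → G)) Subtype.val_injective
  have hpre : IsPartitionOf Set.univ
      ((fun L => ((QuotientGroup.mk : G → G ⧸ N) ⁻¹' L)) '' 𝓛) :=
    h𝓛.preimage QuotientGroup.mk_surjective
  have hNmem : (N : Set G) ∈ (fun L => ((QuotientGroup.mk : G → G ⧸ N) ⁻¹' L)) '' 𝓛 := by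
    refine ⟨{1}, honeQ, ?_⟩
    ext g
    simp [QuotientGroup.eq_one_iff]
  have hchar := hind.diff_singleton hIrrOver
  have hcls := hpre.diff_singleton hNmem
  have h𝒳fin : 𝒳.Finite := (finite_Irr N).finite_subsets.subset h𝒳.2.1
  have h𝒴fin : 𝒴.Finite := (finite_Irr (G ⧸ N)).finite_subsets.subset h𝒴.2.1
  refine ⟨?_, ?_, ?_, Or.inl ⟨{1}, honeN, by simp⟩, ?_⟩
  · have h := hinfl.union hchar Set.disjoint_sdiff_right
    rwa [Set.union_sdiff_cancel fun χ hχ => hχ.1] at h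
  · have h := hsub.union hcls Set.disjoint_sdiff_right
    rwa [Set.union_sdiff_cancel (Set.subset_univ _)] at h
  · rw [Set.ncard_union_eq (hinfl.disjoint_parts hchar Set.disjoint_sdiff_right)
        (h𝒴fin.image _) ((h𝒳fin.image _).sdiff),
      Set.ncard_union_eq (hsub.disjoint_parts hcls Set.disjoint_sdiff_right),
      Set.ncard_sdiff_singleton_of_mem hIrrOver, Set.ncard_sdiff_singleton_of_mem hNmem,
      Set.ncard_image_of_injective _ inflateSet_injective,
      Set.InjOn.ncard_image (injOn_indSet hN h𝒳 hinv),
      Set.ncard_image_of_injective _ (Set.image_injective.2 Subtype.val_injective),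
      Set.ncard_image_of_injective _
        (Set.preimage_injective.2 QuotientGroup.mk_surjective), hcardN, hcardQ]
    have h1 : 0 < 𝒦.ncard := (Set.ncard_pos (Set.toFinite _)).2 ⟨_, honeN⟩
    have h2 : 0 < 𝓛.ncard := (Set.ncard_pos (Set.toFinite _)).2 ⟨_, honeQ⟩
    omega
  · rintro _ (⟨Y, hY, rfl⟩ | ⟨⟨X, hX, rfl⟩, -⟩) K hK g hg h hh
    · rw [sigmaChar_inflateSet, sigmaChar_inflateSet]
      rcases hK with ⟨K, hK, rfl⟩ | ⟨⟨L, hL, rfl⟩, -⟩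
      · obtain ⟨n, -, rfl⟩ := hg
        obtain ⟨m, -, rfl⟩ := hh
        rw [(QuotientGroup.eq_one_iff _).2 n.2, (QuotientGroup.eq_one_iff _).2 m.2]
      · exact hconstQ Y hY L hL _ hg _ hh
    · simp only [sigmaChar_indSet hN (h𝒳.2.1 X hX) (hinv X hX), Pi.smul_apply, zeroExtend]
      rcases hK with hK | hK
      · obtain ⟨K, hK, rfl⟩ := hK
        obtain ⟨n, hn, rfl⟩ := hg
        obtain ⟨m, hm, rfl⟩ := hh
        rw [dif_pos n.2, dif_pos m.2, hconstN X hX K hK n hn m hm]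
      · have hgN : g ∉ N := (hcls.2.1 K hK hg).2
        have hhN : h ∉ N := (hcls.2.1 K hK hh).2
        rw [dif_neg hgN, dif_neg hhN]
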